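/- For every integer N ≥ 2, every ℏ > 0 and every λ = (λ_1,…,λ_N) ∈ ℝ^N, the Givental integral Ψ^{(N)}_λ is a smooth function of x ∈ ℝ^N and is an eigenfunction of the total momentum operator: −iℏ Σ_{i=1}^{N} ∂Ψ^{(N)}_λ/∂x_i = ( Σ_{k=1}^{N} λ_k ) Ψ^{(N)}_λ. -/

import Mathlib

open MeasureTheory

noncomputable section

/-- The index set of the Givental variables `T_{k,i}`, `1 ≤ i ≤ k ≤ N−1`: the pair
`(p₁, p₂) : Fin N × Fin N` encodes `(k, i) = (p₁+1, p₂+1)`. It has `N(N−1)/2` elements. -/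
abbrev GIdx (N : ℕ) : Type :=
  {p : Fin N × Fin N // p.2.val ≤ p.1.val ∧ p.1.val + 1 ≤ N - 1}

/-- The value `T_{k,i}` (1-based indices) of a point `T : GIdx N → ℝ` of the Givental
integration domain, with the boundary convention `T_{N,i} := x_i`; the value is `0` for
out-of-range indices. -/
def gval (N : ℕ) (x : Fin N → ℝ) (T : GIdx N → ℝ) (k i : ℕ) : ℝ :=
  if h : 1 ≤ i ∧ i ≤ k ∧ k ≤ N - 1 then
    T ⟨(⟨k - 1, by omega⟩, ⟨i - 1, by omega⟩),
       ⟨by show i - 1 ≤ k - 1; omega, by show k - 1 + 1 ≤ N - 1; omega⟩⟩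
  else if h' : k = N ∧ 1 ≤ i ∧ i ≤ N then x ⟨i - 1, by omega⟩
  else 0

/-- The Givental potential
`𝓕_N(T; λ, x) = i Σ_{k=1}^{N} λ_k (Σ_{i=1}^{k} T_{k,i} − Σ_{i=1}^{k−1} T_{k−1,i})
 − Σ_{k=1}^{N−1} Σ_{i=1}^{k} (e^{T_{k+1,i} − T_{k,i}} + e^{T_{k,i} − T_{k+1,i+1}})`,
with `T_{N,i} := x_i`. -/
def Fpot (N : ℕ) (lam x : Fin N → ℝ) (T : GIdx N → ℝ) : ℂ :=
  Complex.I * ∑ a : Fin N, (lam a : ℂ) *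
      ((∑ i ∈ Finset.Icc 1 (a.val + 1), (gval N x T (a.val + 1) i : ℂ))
        - ∑ i ∈ Finset.Icc 1 a.val, (gval N x T a.val i : ℂ))
    - ∑ k ∈ Finset.Icc 1 (N - 1), ∑ i ∈ Finset.Icc 1 k,
        ((Real.exp (gval N x T (k + 1) i - gval N x T k i) : ℂ)
          + (Real.exp (gval N x T k i - gval N x T (k + 1) (i + 1)) : ℂ))

/-- The Givental integrand `T ↦ exp( 𝓕_N(T; λ, x) / ℏ )`. -/
def givIntegrand (N : ℕ) (hbar : ℝ) (lam x : Fin N → ℝ) (T : GIdx N → ℝ) : ℂ :=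
  Complex.exp (Fpot N lam x T / (hbar : ℂ))

/-- The Givental integral `Ψ^{(N)}_λ(x) = ∫ exp( 𝓕_N(T; λ, x) / ℏ ) dT` over
`ℝ^{N(N−1)/2}`. -/
def GivPsi (N : ℕ) (hbar : ℝ) (lam : Fin N → ℝ) (x : Fin N → ℝ) : ℂ :=
  ∫ T : GIdx N → ℝ, givIntegrand N hbar lam x T

theorem integrable_exp_neg_mul_abs {c : ℝ} (hc : 0 < c) :
    Integrable (fun t : ℝ => Real.exp (-(c * |t|))) := by
  rw [← integrableOn_univ, ← Set.Iic_union_Ioi (a := (0 : ℝ))]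
  refine IntegrableOn.union ?_ ?_
  · refine (integrableOn_exp_mul_Iic hc 0).congr_fun (fun t ht => ?_) measurableSet_Iic
    simp [abs_of_nonpos (show t ≤ 0 from ht)]
  · refine (integrableOn_exp_mul_Ioi (neg_lt_zero.2 hc) 0).congr_fun (fun t ht => ?_)
      measurableSet_Ioi
    simp [abs_of_pos (show 0 < t from ht)]

section Laplace

variable {ι α E : Type} [Fintype ι] [NormedAddCommGroup E] [NormedSpace ℝ E]
  {p : ι → E →L[ℝ] ℝ} [MeasurableSpace α] {μ : Measure α} {w : α → ι → ℝ}
  {F : Type} [NormedAddCommGroup F] [NormedSpace ℝ F]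

/-- The linear form `y ↦ -∑ i, p i y * v i` tensored with a vector. -/
def negSumSMulRight (p : ι → E →L[ℝ] ℝ) (v : ι → ℝ) (z : F) : E →L[ℝ] F :=
  ∑ i, (-v i) • (p i).smulRight z

theorem hasFDerivAt_exp_neg_sum_smul (v : ι → ℝ) (z : F) (y : E) :
    HasFDerivAt (fun y : E => Real.exp (-∑ i, p i y * v i) • z)
      (Real.exp (-∑ i, p i y * v i) • negSumSMulRight p v z) y := by
  have h : HasFDerivAt (fun y : E => -∑ i, p i y * v i)
      (-∑ i, v i • p i) y := by
    refine (HasFDerivAt.fun_sum fun i _ => ?_).neg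
    exact (p i).hasFDerivAt.mul_const (v i)
  refine (h.exp.smul_const z).congr_fderiv ?_
  ext u
  simp [negSumSMulRight, smul_smul, Finset.sum_smul, Finset.smul_sum]

theorem aestronglyMeasurable_of_integrable_exp_smul (hw : Measurable w) {g : α → F} {y : E}
    (hg : Integrable (fun a => Real.exp (-∑ i, p i y * w a i) • g a) μ) :
    AEStronglyMeasurable g μ := by
  have h : AEStronglyMeasurable (fun a => Real.exp (∑ i, p i y * w a i)) μ := by
    apply Measurable.aestronglyMeasurable
    fun_prop
  refine (h.smul hg.aestronglyMeasurable).congr (.of_forall fun a => ?_)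
  simp [smul_smul, ← Real.exp_add]

theorem integrable_exp_smul_negSumSMulRight (hw : Measurable w) (hw0 : ∀ a i, 0 ≤ w a i)
    {g : α → F}
    (hg : ∀ y : E, (∀ i, 0 < p i y) →
      Integrable (fun a => Real.exp (-∑ i, p i y * w a i) • g a) μ)
    (y : E) (hy : ∀ i, 0 < p i y) :
    Integrable (fun a => Real.exp (-∑ i, p i y * w a i) • negSumSMulRight p (w a) (g a)) μ := by
  have hgm := aestronglyMeasurable_of_integrable_exp_smul hw (hg y hy)
  have hp2 : ∀ i, p i ((1 / 2 : ℝ) • y) = p i y / 2 := fun i => by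
    rw [map_smul, smul_eq_mul]; ring
  have hg2 := hg ((1 / 2 : ℝ) • y) fun i => by rw [hp2]; exact half_pos (hy i)
  simp only [hp2] at hg2
  have key : ∀ i, Integrable (fun a => (Real.exp (-∑ j, p j y * w a j) * -w a i) • g a) μ := by
    intro i
    refine (hg2.norm.const_mul (2 / p i y)).mono'
      (AEStronglyMeasurable.smul ?_ hgm) (.of_forall fun a => ?_)
    · apply Measurable.aestronglyMeasurable
      fun_prop
    · have h1 : w a i ≤ 2 / p i y * Real.exp (∑ j, p j y / 2 * w a j) := by
        have h2 : p i y / 2 * w a i ≤ ∑ j, p j y / 2 * w a j :=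
          Finset.single_le_sum (f := fun j => p j y / 2 * w a j)
            (fun j _ => mul_nonneg (half_pos (hy j)).le (hw0 a j)) (Finset.mem_univ i)
        have h3 := Real.add_one_le_exp (∑ j, p j y / 2 * w a j)
        have h4 := hy i
        rw [div_mul_eq_mul_div, le_div_iff₀ h4]
        linarith
      have h5 : Real.exp (-∑ j, p j y * w a j)
          = Real.exp (-∑ j, p j y / 2 * w a j) * Real.exp (-∑ j, p j y / 2 * w a j) := by
        rw [← Real.exp_add]
        congr 1
        rw [← neg_add, ← Finset.sum_add_distrib]
        congr 1
        exact Finset.sum_congr rfl fun j _ => by ring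
      rw [norm_smul, norm_smul, norm_mul, norm_neg, Real.norm_of_nonneg (hw0 a i),
        Real.norm_of_nonneg (Real.exp_nonneg _), Real.norm_of_nonneg (Real.exp_nonneg _), h5,
        ← mul_assoc]
      refine mul_le_mul_of_nonneg_right ?_ (norm_nonneg _)
      calc _ ≤ Real.exp (-∑ j, p j y / 2 * w a j) * Real.exp (-∑ j, p j y / 2 * w a j)
            * (2 / p i y * Real.exp (∑ j, p j y / 2 * w a j)) := by gcongr
        _ = 2 / p i y * Real.exp (-∑ j, p j y / 2 * w a j)
            * (Real.exp (-∑ j, p j y / 2 * w a j) * Real.exp (∑ j, p j y / 2 * w a j)) := by ring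
        _ = _ := by rw [← Real.exp_add, neg_add_cancel, Real.exp_zero, mul_one]
  have h := integrable_finsetSum Finset.univ fun i (_ : i ∈ Finset.univ) =>
    (ContinuousLinearMap.smulRightL ℝ E F (p i)).integrable_comp (key i)
  refine h.congr (.of_forall fun a => ?_)
  ext u
  simp [negSumSMulRight, smul_smul, Finset.smul_sum, mul_comm, mul_left_comm]

theorem hasFDerivAt_integral_exp_neg_sum_smul (hw : Measurable w) (hw0 : ∀ a i, 0 ≤ w a i)
    {g : α → F}
    (hg : ∀ y : E, (∀ i, 0 < p i y) →
      Integrable (fun a => Real.exp (-∑ i, p i y * w a i) • g a) μ)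
    (y : E) (hy : ∀ i, 0 < p i y) :
    HasFDerivAt (fun y : E => ∫ a, Real.exp (-∑ i, p i y * w a i) • g a ∂μ)
      (∫ a, Real.exp (-∑ i, p i y * w a i) • negSumSMulRight p (w a) (g a) ∂μ) y := by
  have hgm := aestronglyMeasurable_of_integrable_exp_smul hw (hg y hy)
  have hint := integrable_exp_smul_negSumSMulRight hw hw0 hg
  have hp2 : ∀ i, p i ((1 / 2 : ℝ) • y) = p i y / 2 := fun i => by
    rw [map_smul, smul_eq_mul]; ring
  have hint2 := hint ((1 / 2 : ℝ) • y) fun i => by rw [hp2]; exact half_pos (hy i)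
  simp only [hp2] at hint2
  have hs : {z : E | ∀ i, p i y / 2 < p i z} ∈ nhds y := by
    refine IsOpen.mem_nhds ?_ fun i => half_lt_self (hy i)
    simp only [Set.ofPred_forall]
    exact isOpen_iInter_of_finite fun i => isOpen_lt continuous_const (p i).continuous
  refine hasFDerivAt_integral_of_dominated_of_fderiv_le
    (F' := fun z a => Real.exp (-∑ i, p i z * w a i) • negSumSMulRight p (w a) (g a)) hs
    (.of_forall fun z => ?_) (hg y hy) (hint y hy).aestronglyMeasurable
    (.of_forall fun a z hz => ?_)
    hint2.norm
    (.of_forall fun a z _ => hasFDerivAt_exp_neg_sum_smul _ _ _)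
  · refine AEStronglyMeasurable.smul ?_ hgm
    apply Measurable.aestronglyMeasurable
    fun_prop
  · rw [norm_smul, norm_smul]
    refine mul_le_mul_of_nonneg_right ?_ (norm_nonneg _)
    rw [Real.norm_of_nonneg (Real.exp_nonneg _), Real.norm_of_nonneg (Real.exp_nonneg _),
      Real.exp_le_exp, neg_le_neg_iff]
    exact Finset.sum_le_sum fun i _ => mul_le_mul_of_nonneg_right (hz i).le (hw0 a i)

end Laplace

/-- The Laplace transform of a vector-valued density is smooth on the positive orthant as soon as
it converges absolutely there. -/
theorem contDiffOn_integral_exp_neg_sum_smul {ι α E : Type} [Fintype ι] [NormedAddCommGroup E]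
    [NormedSpace ℝ E] {p : ι → E →L[ℝ] ℝ} [MeasurableSpace α]
    {μ : Measure α} {w : α → ι → ℝ} (hw : Measurable w) (hw0 : ∀ a i, 0 ≤ w a i) (n : ℕ) :
    ∀ {F : Type} [NormedAddCommGroup F] [NormedSpace ℝ F] {g : α → F},
      (∀ y : E, (∀ i, 0 < p i y) →
        Integrable (fun a => Real.exp (-∑ i, p i y * w a i) • g a) μ) →
      ContDiffOn ℝ n (fun y : E => ∫ a, Real.exp (-∑ i, p i y * w a i) • g a ∂μ)
        {y | ∀ i, 0 < p i y} := by
  have ho : IsOpen {y : E | ∀ i, 0 < p i y} := by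
    simp only [Set.ofPred_forall]
    exact isOpen_iInter_of_finite fun i => isOpen_lt continuous_const (p i).continuous
  induction n with
  | zero =>
    intro F _ _ g hg
    rw [Nat.cast_zero, contDiffOn_zero]
    exact fun y hy => (hasFDerivAt_integral_exp_neg_sum_smul hw hw0 hg y
      hy).continuousAt.continuousWithinAt
  | succ n ih =>
    intro F _ _ g hg
    have hd := hasFDerivAt_integral_exp_neg_sum_smul hw hw0 hg
    rw [Nat.cast_add, Nat.cast_one, contDiffOn_succ_iff_fderiv_of_isOpen ho]
    refine ⟨fun y hy => (hd y hy).differentiableAt.differentiableWithinAt, by simp, ?_⟩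
    exact (ih (g := fun a => negSumSMulRight p (w a) (g a)) (integrable_exp_smul_negSumSMulRight hw hw0 hg)).congr fun y hy =>
      (hd y hy).fderiv

/-- The indices `(k, i)`, `1 ≤ i ≤ k ≤ N − 1`, of the inner double sum of the potential. -/
abbrev gsigma (N : ℕ) : Finset (Σ _ : ℕ, ℕ) :=
  (Finset.Icc 1 (N - 1)).sigma fun k => Finset.Icc 1 k

/-- The exponents of the exponential terms of the potential. -/
def gexponent (N : ℕ) (x : Fin N → ℝ) (T : GIdx N → ℝ) : gsigma N ⊕ gsigma N → ℝ
  | .inl q => gval N x T (q.1.1 + 1) q.1.2 - gval N x T q.1.1 q.1.2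
  | .inr q => gval N x T q.1.1 q.1.2 - gval N x T (q.1.1 + 1) (q.1.2 + 1)

/-- The linear part of the potential, without its factor `i`. -/
def gphase (N : ℕ) (lam x : Fin N → ℝ) (T : GIdx N → ℝ) : ℝ :=
  ∑ a : Fin N, lam a * ((∑ i ∈ Finset.Icc 1 (a.val + 1), gval N x T (a.val + 1) i)
    - ∑ i ∈ Finset.Icc 1 a.val, gval N x T a.val i)

theorem Fpot_eq (N : ℕ) (lam x : Fin N → ℝ) (T : GIdx N → ℝ) :
    Fpot N lam x T
      = Complex.I * (gphase N lam x T : ℂ)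
        - ((∑ j, Real.exp (gexponent N x T j) : ℝ) : ℂ) := by
  have h : ∑ k ∈ Finset.Icc 1 (N - 1), ∑ i ∈ Finset.Icc 1 k,
        (Real.exp (gval N x T (k + 1) i - gval N x T k i)
          + Real.exp (gval N x T k i - gval N x T (k + 1) (i + 1)))
      = ∑ j, Real.exp (gexponent N x T j) := by
    rw [Fintype.sum_sum_type, ← Finset.sum_add_distrib, Finset.sum_sigma']
    exact (Finset.sum_coe_sort (gsigma N) fun q : (Σ _ : ℕ, ℕ) =>
      Real.exp (gval N x T (q.1 + 1) q.2 - gval N x T q.1 q.2)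
        + Real.exp (gval N x T q.1 q.2 - gval N x T (q.1 + 1) (q.2 + 1))).symm
  rw [← h, Fpot, gphase]
  push_cast
  rfl

theorem gval_eq_add (N : ℕ) (x : Fin N → ℝ) (T : GIdx N → ℝ) (k i : ℕ) :
    gval N x T k i = gval N x 0 k i + gval N 0 T k i := by
  unfold gval
  split_ifs <;> simp

theorem gexponent_eq_add (N : ℕ) (x : Fin N → ℝ) (T : GIdx N → ℝ) (j : gsigma N ⊕ gsigma N) :
    gexponent N x T j = gexponent N x 0 j + gexponent N 0 T j := by
  rcases j with q | q <;> simp only [gexponent, gval_eq_add N x T] <;> ring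

theorem gphase_eq_add (N : ℕ) (lam x : Fin N → ℝ) (T : GIdx N → ℝ) :
    gphase N lam x T = gphase N lam x 0 + gphase N lam 0 T := by
  simp only [gphase, gval_eq_add N x T, Finset.sum_add_distrib, mul_add, add_sub_add_comm]

theorem givIntegrand_eq (N : ℕ) (hbar : ℝ) (lam x : Fin N → ℝ) (T : GIdx N → ℝ) :
    givIntegrand N hbar lam x T
      = Complex.exp (Complex.I * (gphase N lam x 0 : ℂ) / hbar)
        * (Real.exp (-∑ j, Real.exp (gexponent N x 0 j) / hbar * Real.exp (gexponent N 0 T j))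
          • Complex.exp (Complex.I * (gphase N lam 0 T : ℂ) / hbar)) := by
  rw [givIntegrand, Fpot_eq, gphase_eq_add N lam x T, Complex.real_smul, Complex.ofReal_exp,
    ← Complex.exp_add, ← Complex.exp_add]
  simp only [gexponent_eq_add N x T, Real.exp_add, div_mul_eq_mul_div, ← Finset.sum_div]
  congr 1
  push_cast
  ring

theorem contDiff_gval_left (N k i : ℕ) (T : GIdx N → ℝ) {n : WithTop ℕ∞} :
    ContDiff ℝ n fun x => gval N x T k i := by
  unfold gval
  split_ifs <;> fun_prop

theorem continuous_gval_right (N k i : ℕ) (x : Fin N → ℝ) :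
    Continuous fun T => gval N x T k i := by
  unfold gval
  split_ifs <;> fun_prop

theorem contDiff_gexponent_left (N : ℕ) (T : GIdx N → ℝ) (j : gsigma N ⊕ gsigma N)
    {n : WithTop ℕ∞} : ContDiff ℝ n fun x => gexponent N x T j := by
  rcases j with q | q <;> exact (contDiff_gval_left ..).sub (contDiff_gval_left ..)

theorem continuous_gexponent_right (N : ℕ) (x : Fin N → ℝ) (j : gsigma N ⊕ gsigma N) :
    Continuous fun T => gexponent N x T j := by
  rcases j with q | q <;> exact (continuous_gval_right ..).sub (continuous_gval_right ..)

theorem contDiff_gphase_left (N : ℕ) (lam : Fin N → ℝ) (T : GIdx N → ℝ) {n : WithTop ℕ∞} :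
    ContDiff ℝ n fun x => gphase N lam x T := by
  have := fun k i => contDiff_gval_left N k i T (n := n)
  unfold gphase
  fun_prop

theorem continuous_gphase_right (N : ℕ) (lam x : Fin N → ℝ) :
    Continuous fun T => gphase N lam x T := by
  have := fun k i => continuous_gval_right N k i x
  unfold gphase
  fun_prop

theorem abs_gval_le (N : ℕ) (T : GIdx N → ℝ) (d : ℕ) :
    ∀ k i : ℕ, 1 ≤ i → i ≤ k → k + d = N →
      |gval N 0 T k i| ≤ d * ∑ j, Real.exp (gexponent N 0 T j) := by
  have hterm : ∀ j, gexponent N 0 T j ≤ ∑ j, Real.exp (gexponent N 0 T j) := fun j =>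
    (by linarith [Real.add_one_le_exp (gexponent N 0 T j)] :
      gexponent N 0 T j ≤ Real.exp (gexponent N 0 T j)).trans
      (Finset.single_le_sum (f := fun j => Real.exp (gexponent N 0 T j))
        (fun j _ => (Real.exp_pos _).le) (Finset.mem_univ j))
  induction d with
  | zero =>
    intro k i h1 h2 h3
    have : ¬ (1 ≤ i ∧ i ≤ k ∧ k ≤ N - 1) := by omega
    simp [gval, this]
  | succ d ih =>
    intro k i h1 h2 h3
    have hq : (⟨k, i⟩ : Σ _ : ℕ, ℕ) ∈ gsigma N := by
      simp only [gsigma, Finset.mem_sigma, Finset.mem_Icc]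
      omega
    have e1 := hterm (.inl ⟨_, hq⟩)
    have e2 := hterm (.inr ⟨_, hq⟩)
    have i1 := abs_le.1 (ih (k + 1) i h1 (by omega) (by omega))
    have i2 := abs_le.1 (ih (k + 1) (i + 1) (by omega) (by omega) (by omega))
    simp only [gexponent] at e1 e2 i1 i2 ⊢
    push_cast
    rw [abs_le]
    constructor <;> linarith [i1.1, i2.2]

theorem sum_abs_le (N : ℕ) (T : GIdx N → ℝ) :
    ∑ p, |T p| ≤ ((Fintype.card (GIdx N) * N : ℕ) : ℝ) * ∑ j, Real.exp (gexponent N 0 T j) := by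
  have hS : 0 ≤ ∑ j, Real.exp (gexponent N 0 T j) :=
    Finset.sum_nonneg fun j _ => (Real.exp_pos _).le
  have h : ∀ p, |T p| ≤ N * ∑ j, Real.exp (gexponent N 0 T j) := by
    rintro ⟨⟨a, b⟩, h1, h2⟩
    have h1' : b.val ≤ a.val := h1
    have h2' : a.val + 1 ≤ N - 1 := h2
    have h := abs_gval_le N T (N - (a.val + 1)) (a.val + 1) (b.val + 1) (by omega) (by omega)
      (by omega)
    have hc : 1 ≤ b.val + 1 ∧ b.val + 1 ≤ a.val + 1 ∧ a.val + 1 ≤ N - 1 := by omega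
    rw [gval, dif_pos hc] at h
    refine h.trans (mul_le_mul_of_nonneg_right ?_ hS)
    exact_mod_cast Nat.sub_le _ _
  refine (Finset.sum_le_sum fun p _ => h p).trans_eq ?_
  rw [Finset.sum_const, Finset.card_univ, nsmul_eq_mul]
  push_cast
  ring

theorem integrable_exp_neg_mul_sum_exp_gexponent (N : ℕ) {m : ℝ} (hm : 0 < m) :
    Integrable fun T : GIdx N → ℝ => Real.exp (-(m * ∑ j, Real.exp (gexponent N 0 T j))) := by
  set C : ℝ := ((Fintype.card (GIdx N) * N : ℕ) : ℝ)
  have hC0 : 0 ≤ C := Nat.cast_nonneg _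
  have hc : 0 < m / (C + 1) := by positivity
  have h : Integrable fun T : GIdx N → ℝ => ∏ p, Real.exp (-(m / (C + 1) * |T p|)) :=
    Integrable.fintype_prod fun _ => integrable_exp_neg_mul_abs hc
  refine h.mono' ?_ (.of_forall fun T => ?_)
  · have := continuous_gexponent_right N 0
    exact Continuous.aestronglyMeasurable (by fun_prop)
  · rw [Real.norm_of_nonneg (Real.exp_nonneg _), ← Real.exp_sum, Real.exp_le_exp,
      Finset.sum_neg_distrib, neg_le_neg_iff, ← Finset.mul_sum, div_mul_eq_mul_div,
      div_le_iff₀ (by positivity), mul_assoc]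
    refine mul_le_mul_of_nonneg_left ?_ hm.le
    have hS : 0 ≤ ∑ j, Real.exp (gexponent N 0 T j) :=
      Finset.sum_nonneg fun j _ => (Real.exp_pos _).le
    linarith [sum_abs_le N T]

theorem integrable_exp_neg_sum_smul_cexp_gphase (N : ℕ) (hbar : ℝ) (lam : Fin N → ℝ)
    (y : gsigma N ⊕ gsigma N → ℝ) (hy : ∀ j, 0 < y j) :
    Integrable fun T : GIdx N → ℝ =>
      Real.exp (-∑ j, y j * Real.exp (gexponent N 0 T j))
        • Complex.exp (Complex.I * (gphase N lam 0 T : ℂ) / hbar) := by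
  obtain ⟨m, hm, hmy⟩ : ∃ m : ℝ, 0 < m ∧ ∀ j, m ≤ y j := by
    rcases isEmpty_or_nonempty (gsigma N ⊕ gsigma N) with h | h
    · exact ⟨1, one_pos, fun j => h.elim j⟩
    · obtain ⟨j, hj⟩ := Finite.exists_min y
      exact ⟨y j, hy j, hj⟩
  refine (integrable_exp_neg_mul_sum_exp_gexponent N hm).mono' ?_ (.of_forall fun T => ?_)
  · have := continuous_gexponent_right N 0
    have := continuous_gphase_right N lam 0
    exact Continuous.aestronglyMeasurable (by fun_prop)
  · have h1 : Complex.I * (gphase N lam 0 T : ℂ) / hbar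
        = ((gphase N lam 0 T / hbar : ℝ) : ℂ) * Complex.I := by
      push_cast
      ring
    rw [norm_smul, h1, Complex.norm_exp_ofReal_mul_I, mul_one,
      Real.norm_of_nonneg (Real.exp_nonneg _), Real.exp_le_exp, neg_le_neg_iff, Finset.mul_sum]
    exact Finset.sum_le_sum fun j _ => mul_le_mul_of_nonneg_right (hmy j) (Real.exp_pos _).le

theorem contDiff_GivPsi (N : ℕ) {hbar : ℝ} (hhbar : 0 < hbar) (lam : Fin N → ℝ) :
    ContDiff ℝ (⊤ : ℕ∞) (GivPsi N hbar lam) := by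
  have hψ : GivPsi N hbar lam = fun x =>
      Complex.exp (Complex.I * (gphase N lam x 0 : ℂ) / hbar)
        * ∫ T : GIdx N → ℝ,
          Real.exp (-∑ j, Real.exp (gexponent N x 0 j) / hbar * Real.exp (gexponent N 0 T j))
            • Complex.exp (Complex.I * (gphase N lam 0 T : ℂ) / hbar) := by
    ext x
    simp only [GivPsi, givIntegrand_eq, integral_const_mul]
  rw [hψ, contDiff_infty]
  intro n
  refine ContDiff.mul ?_ ?_
  · have := contDiff_gphase_left N lam 0 (n := n)
    have := Complex.ofRealCLM.contDiff.comp this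
    exact ((contDiff_const.mul this).div_const _).cexp
  · have hL := contDiffOn_integral_exp_neg_sum_smul
      (p := fun j => ContinuousLinearMap.proj (R := ℝ) (φ := fun _ : gsigma N ⊕ gsigma N => ℝ) j)
      (μ := (volume : Measure (GIdx N → ℝ)))
      (w := fun T j => Real.exp (gexponent N 0 T j))
      (measurable_pi_lambda _ fun j => (continuous_gexponent_right N 0 j).rexp.measurable)
      (fun T j => (Real.exp_pos _).le) n
      (g := fun T => Complex.exp (Complex.I * (gphase N lam 0 T : ℂ) / hbar))
      (integrable_exp_neg_sum_smul_cexp_gphase N hbar lam)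
    have hy : ContDiff ℝ n fun (x : Fin N → ℝ) (j : gsigma N ⊕ gsigma N) =>
        Real.exp (gexponent N x 0 j) / hbar :=
      contDiff_pi.2 fun j => (contDiff_gexponent_left N 0 j).exp.div_const _
    exact hL.comp_contDiff hy fun x j => div_pos (Real.exp_pos _) hhbar

theorem gval_add_const (N : ℕ) (x : Fin N → ℝ) (T : GIdx N → ℝ) (c : ℝ) {k i : ℕ}
    (h1 : 1 ≤ i) (h2 : i ≤ k) (h3 : k ≤ N) :
    gval N (x + fun _ => c) (T + fun _ => c) k i = gval N x T k i + c := by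
  unfold gval
  split_ifs
  · rfl
  · rfl
  · omega

theorem gexponent_add_const (N : ℕ) (x : Fin N → ℝ) (T : GIdx N → ℝ) (c : ℝ)
    (j : gsigma N ⊕ gsigma N) :
    gexponent N (x + fun _ => c) (T + fun _ => c) j = gexponent N x T j := by
  rcases j with ⟨⟨k, i⟩, hq⟩ | ⟨⟨k, i⟩, hq⟩ <;>
  · simp only [gsigma, Finset.mem_sigma, Finset.mem_Icc] at hq
    simp only [gexponent]
    rw [gval_add_const _ _ _ _ (by omega) (by omega) (by omega),
      gval_add_const _ _ _ _ (by omega) (by omega) (by omega)]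
    ring

theorem gphase_add_const (N : ℕ) (lam x : Fin N → ℝ) (T : GIdx N → ℝ) (c : ℝ) :
    gphase N lam (x + fun _ => c) (T + fun _ => c) = gphase N lam x T + c * ∑ a, lam a := by
  have h : ∀ k ≤ N, ∑ i ∈ Finset.Icc 1 k, gval N (x + fun _ => c) (T + fun _ => c) k i
      = (∑ i ∈ Finset.Icc 1 k, gval N x T k i) + k * c := by
    intro k hk
    rw [Finset.sum_congr rfl fun i hi => gval_add_const N x T c (Finset.mem_Icc.1 hi).1
      (Finset.mem_Icc.1 hi).2 hk, Finset.sum_add_distrib]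
    simp
  simp only [gphase]
  rw [Finset.mul_sum, ← Finset.sum_add_distrib]
  refine Finset.sum_congr rfl fun a _ => ?_
  rw [h _ (by omega), h _ (by omega)]
  push_cast
  ring

theorem GivPsi_add_const (N : ℕ) (hbar : ℝ) (lam x : Fin N → ℝ) (c : ℝ) :
    GivPsi N hbar lam (x + fun _ => c)
      = Complex.exp (c * (Complex.I * (∑ a, (lam a : ℂ)) / hbar)) * GivPsi N hbar lam x := by
  simp only [GivPsi]
  rw [← integral_add_right_eq_self _ (fun _ => c : GIdx N → ℝ), ← integral_const_mul]
  refine integral_congr_ae (.of_forall fun T => ?_)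
  simp only [givIntegrand, Fpot_eq, gexponent_add_const, gphase_add_const]
  rw [← Complex.exp_add]
  congr 1
  push_cast
  ring

/-- the Givental integral `Ψ^{(N)}_λ` is a smooth function of `x ∈ ℝ^N` and
is an eigenfunction of the total momentum operator:
`−iℏ Σ_i ∂Ψ/∂x_i = (Σ_k λ_k) Ψ`. -/
theorem givental_momentum_eigenfunction (N : ℕ) (hN : 2 ≤ N)
    (hbar : ℝ) (hhbar : 0 < hbar) (lam : Fin N → ℝ) :
    ContDiff ℝ (⊤ : ℕ∞) (GivPsi N hbar lam) ∧
    ∀ x : Fin N → ℝ,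
      -(Complex.I * (hbar : ℂ)) *
          ∑ i : Fin N, fderiv ℝ (GivPsi N hbar lam) x (Pi.single i 1)
      = (∑ k : Fin N, (lam k : ℂ)) * GivPsi N hbar lam x := by
  refine ⟨contDiff_GivPsi N hhbar lam, fun x => ?_⟩
  have hd : HasFDerivAt (GivPsi N hbar lam) (fderiv ℝ (GivPsi N hbar lam) x) x :=
    ((contDiff_GivPsi N hhbar lam).differentiable (by simp)).differentiableAt.hasFDerivAt
  have hl : HasDerivAt (fun c : ℝ => x + fun _ => c) (fun _ => 1) 0 :=
    (hasDerivAt_pi.2 fun _ => hasDerivAt_id (0 : ℝ)).const_add x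
  have h0 : (x + fun _ => (0 : ℝ)) = x := add_zero x
  have h1 := (h0.symm ▸ hd : HasFDerivAt (GivPsi N hbar lam) (fderiv ℝ (GivPsi N hbar lam) x)
    (x + fun _ => (0 : ℝ))).comp_hasDerivAt (0 : ℝ) hl
  have h2 : HasDerivAt (fun c : ℝ =>
      Complex.exp (c * (Complex.I * (∑ a, (lam a : ℂ)) / hbar)) * GivPsi N hbar lam x)
      (Complex.I * (∑ a, (lam a : ℂ)) / hbar * GivPsi N hbar lam x) 0 := by
    have h3 : HasDerivAt (fun c : ℝ => (c : ℂ) * (Complex.I * (∑ a, (lam a : ℂ)) / hbar))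
        (1 * (Complex.I * (∑ a, (lam a : ℂ)) / hbar)) 0 :=
      (Complex.ofRealCLM.hasDerivAt (x := (0 : ℝ))).mul_const _
    simpa using h3.cexp.mul_const (GivPsi N hbar lam x)
  have h4 : fderiv ℝ (GivPsi N hbar lam) x (fun _ => 1)
      = Complex.I * (∑ a, (lam a : ℂ)) / hbar * GivPsi N hbar lam x :=
    h1.unique (h2.congr_of_eventuallyEq (.of_forall fun c => GivPsi_add_const N hbar lam x c))
  rw [← map_sum, Finset.univ_sum_single, h4]
  have hb : (hbar : ℂ) ≠ 0 := Complex.ofReal_ne_zero.2 hhbar.ne'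
  field_simp
  rw [Complex.I_sq]
  ring
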